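/- For every i ≥ 1, the set P^(i) is the disjoint union of 𝔓^(i) and 𝔓^(i+1); that is, P^(i) = 𝔓^(i) ∪ 𝔓^(i+1) and 𝔓^(i) ∩ 𝔓^(i+1) = ∅. -/

import Mathlib

/-- `nthPrime n` is the `n`-th prime number, 1-indexed: `nthPrime 1 = 2`, `nthPrime 2 = 3`, ... -/
noncomputable def nthPrime (n : ℕ) : ℕ := Nat.nth Nat.Prime (n - 1)

/-- For a set `S` of positive integers, `indexedSet S = {p_n : n ∈ S}`. -/
def indexedSet (S : Set ℕ) : Set ℕ := {m | ∃ n ∈ S, m = nthPrime n}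

/-- The higher-order prime sets: `P 1` is the set of all primes, and `P (k+1) = indexedSet (P k)`
for `k ≥ 1`.  (`P 0` is a junk value.) -/
def P : ℕ → Set ℕ
  | 0 => ∅
  | 1 => {p | p.Prime}
  | (k + 2) => indexedSet (P (k + 1))

/-- The alternating-sum set `𝔓^(i) = ⋃_{j≥0} (P^(i+2j) \ P^(i+2j+1))`. -/
def altSet (i : ℕ) : Set ℕ := ⋃ j : ℕ, (P (i + 2 * j) \ P (i + 2 * j + 1))

theorem P_succ_subset (k : ℕ) : P (k + 2) ⊆ P (k + 1) := by
  induction k with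
  | zero =>
    rintro m ⟨n, _, rfl⟩
    exact Nat.prime_nth_prime _
  | succ k ih =>
    rintro m ⟨n, hn, rfl⟩
    exact ⟨n, ih hn, rfl⟩

theorem P_lower_bound (k : ℕ) : ∀ m ∈ P (k + 1), k + 2 ≤ m := by
  induction k with
  | zero =>
    intro m hm
    exact Nat.Prime.two_le hm
  | succ k ih =>
    rintro m ⟨n, hn, rfl⟩
    have h1 := ih n hn
    have h2 := Nat.add_two_le_nth_prime (n - 1)
    unfold nthPrime
    omega

theorem P_anti {a b : ℕ} (ha : 1 ≤ a) (hab : a ≤ b) : P b ⊆ P a := by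
  induction b, hab using Nat.le_induction with
  | base => exact subset_rfl
  | succ b hb ih =>
    obtain ⟨c, rfl⟩ : ∃ c, b = c + 1 := ⟨b - 1, by omega⟩
    exact (P_succ_subset c).trans ih

/-- For every `i ≥ 1`, `P^(i)` is the disjoint union of `𝔓^(i)` and `𝔓^(i+1)`. -/
theorem higher_order_primes_eq_union_altSets (i : ℕ) (hi : 1 ≤ i) :
    P i = altSet i ∪ altSet (i + 1) ∧ altSet i ∩ altSet (i + 1) = ∅ := by
  constructor
  · ext m
    simp only [altSet, Set.mem_union, Set.mem_iUnion, Set.mem_diff]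
    constructor
    · intro hm
      classical
      have hex : ∃ d, m ∉ P (i + d + 1) := by
        refine ⟨m, fun h => ?_⟩
        have := P_lower_bound (i + m) m h
        omega
      have hs := Nat.find_spec hex
      have hmin : ∀ d, d < Nat.find hex → m ∈ P (i + d + 1) := fun d hd => by
        simpa using Nat.find_min hex hd
      generalize Nat.find hex = d at hs hmin
      have hd : m ∈ P (i + d) := by
        cases d with
        | zero => exact hm
        | succ e => exact hmin e (by omega)
      rcases Nat.even_or_odd' d with ⟨j, rfl | rfl⟩
      · exact Or.inl ⟨j, hd, hs⟩
      · refine Or.inr ⟨j, ?_⟩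
        rw [show i + 1 + 2 * j = i + (2 * j + 1) by ring]
        exact ⟨hd, hs⟩
    · rintro (⟨j, h, _⟩ | ⟨j, h, _⟩)
      · exact P_anti hi (by omega) h
      · exact P_anti hi (by omega) h
  · ext m
    simp only [altSet, Set.mem_inter_iff, Set.mem_iUnion, Set.mem_diff, Set.mem_empty_iff_false,
      iff_false]
    rintro ⟨⟨j, h1, h2⟩, ⟨l, h3, h4⟩⟩
    rcases Nat.lt_or_ge l j with h | h
    · exact h4 (P_anti (by omega) (by omega) h1)
    · exact h2 (P_anti (by omega) (by omega) h3)
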